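/- arXiv:2112.01592 — 4 statements merged into one kernel-verified Lean document; each statement's English description precedes it below -/
import Mathlib

section
/- Let 0 < m ≤ M, 0 ≤ H_n ≤ (M−m)/M, 0 ≤ H_p ≤ (M−m)/m, and p ∈ [m, M]. Define the Robust-Mix reservation price q as follows: q = (1−H_n)·p if (1+H_p)/(1−H_n) ≤ √(M/m), and q = √(m·M) otherwise. Then for every nonempty finite sequence σ of prices in [m, M] whose best price p* = max σ equals p(1−η) for some η ∈ [0, H_n] or p(1+η) for some η ∈ [0, H_p], one has p* / RP(q, σ) ≤ √(M/m); that is, Robust-Mix is robust. (The √(M/m) component of Theorem 3.) -/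
/-- Profit of the reservation algorithm with reservation price `q` on a price
sequence: the first price that is at least `q`, or the last price if none. -/
noncomputable def RP (q : ℝ) : List ℝ → ℝ
  | [] => 0
  | [x] => x
  | x :: xs => if q ≤ x then x else RP q xs

theorem RP_mem (q : ℝ) : ∀ {σ : List ℝ}, σ ≠ [] → RP q σ ∈ σ
  | [], h => absurd rfl h
  | [x], _ => by simp [RP]
  | x :: y :: xs, _ => by
    rw [RP]
    · split_ifs
      · exact List.mem_cons_self
      · exact List.mem_cons_of_mem _ (RP_mem q (List.cons_ne_nil y xs))
    · simp

theorem le_RP_of_mem {q a : ℝ} (hqa : q ≤ a) : ∀ {σ : List ℝ}, a ∈ σ → q ≤ RP q σ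
  | [], h => absurd h List.not_mem_nil
  | [x], h => by
    rw [List.mem_singleton] at h
    simpa [RP, ← h] using hqa
  | x :: y :: xs, h => by
    rw [RP]
    · split_ifs with hx
      · exact hx
      · rcases List.mem_cons.1 h with rfl | h
        · exact absurd hqa hx
        · exact le_RP_of_mem hqa h
    · simp

theorem stmt5 (m M Hn Hp p q : ℝ)
    (hm : 0 < m) (hmM : m ≤ M)
    (hHn0 : 0 ≤ Hn) (hHn : Hn ≤ (M - m) / M)
    (hHp0 : 0 ≤ Hp) (hHp : Hp ≤ (M - m) / m)
    (hp : p ∈ Set.Icc m M)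
    (hq1 : (1 + Hp) / (1 - Hn) ≤ Real.sqrt (M / m) → q = (1 - Hn) * p)
    (hq2 : ¬ ((1 + Hp) / (1 - Hn) ≤ Real.sqrt (M / m)) → q = Real.sqrt (m * M)) :
    ∀ σ : List ℝ, ∀ pstar : ℝ,
      (∀ x ∈ σ, x ∈ Set.Icc m M) → pstar ∈ σ → (∀ x ∈ σ, x ≤ pstar) →
      ((∃ η ∈ Set.Icc 0 Hn, pstar = p * (1 - η)) ∨
       (∃ η ∈ Set.Icc 0 Hp, pstar = p * (1 + η))) →
      pstar / RP q σ ≤ Real.sqrt (M / m) := by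
  intro σ pstar hσ hmem _ hη
  have hM : 0 < M := hm.trans_le hmM
  have hp0 : 0 < p := hm.trans_le hp.1
  have hHn1 : 0 < 1 - Hn := by
    have h : (M - m) / M < 1 := by rw [div_lt_one hM]; linarith
    linarith
  have hRPm : m ≤ RP q σ := (hσ _ (RP_mem q (List.ne_nil_of_mem hmem))).1
  have hRP0 : 0 < RP q σ := hm.trans_le hRPm
  by_cases hc : (1 + Hp) / (1 - Hn) ≤ Real.sqrt (M / m)
  · have hbounds : (1 - Hn) * p ≤ pstar ∧ pstar ≤ p * (1 + Hp) := by
      rcases hη with ⟨η, ⟨h0, h1⟩, rfl⟩ | ⟨η, ⟨h0, h1⟩, rfl⟩ <;> constructor <;> nlinarith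
    have hq := hq1 hc
    have hqRP : q ≤ RP q σ := le_RP_of_mem (hq ▸ hbounds.1) hmem
    have hq0 : 0 < q := hq ▸ mul_pos hHn1 hp0
    calc pstar / RP q σ ≤ p * (1 + Hp) / q := by
          gcongr
          exact hbounds.2
      _ = (1 + Hp) / (1 - Hn) := by rw [hq]; field_simp
      _ ≤ _ := hc
  · have hq := hq2 hc
    have hs : 0 < Real.sqrt m := Real.sqrt_pos.2 hm
    have ht : 0 < Real.sqrt M := Real.sqrt_pos.2 hM
    have hss : Real.sqrt m ^ 2 = m := Real.sq_sqrt hm.le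
    have htt : Real.sqrt M ^ 2 = M := Real.sq_sqrt hM.le
    rw [Real.sqrt_mul hm.le] at hq
    rw [Real.sqrt_div hM.le, div_le_div_iff₀ hRP0 hs]
    rcases le_or_gt q pstar with h | h
    · have hqRP : q ≤ RP q σ := le_RP_of_mem h hmem
      calc pstar * Real.sqrt m ≤ M * Real.sqrt m := by
            gcongr
            exact (hσ _ hmem).2
        _ = Real.sqrt M * q := by rw [hq]; nth_rewrite 1 [← htt]; ring
        _ ≤ _ := by gcongr
    · calc pstar * Real.sqrt m ≤ q * Real.sqrt m := by gcongr
        _ = Real.sqrt M * m := by rw [hq]; nth_rewrite 3 [← hss]; ring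
        _ ≤ _ := by gcongr
end

section
/- Let 0 < m ≤ M, 0 ≤ H_n ≤ (M−m)/M, 0 ≤ H_p ≤ (M−m)/m, and suppose (1+H_p)/(1−H_n) ≤ √(M/m). Let p ∈ [m, M] and let σ be a nonempty finite sequence of prices in [m, M] with best price p* = max σ = p(1−η) for some η ∈ [0, H_n] (negative error at most H_n). Then the algorithm Robust-Mix, which in this case uses reservation price p' = p(1−H_n), satisfies p* / RP(p', σ) ≤ (1−η)/(1−H_n) ≤ √(M/m); in particular p*/RP(p', σ) ≤ min{(1−η)/(1−H_n), √(M/m)}. (Theorem 3, negative-error case.) -/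
theorem le_RP_of_mem_s6 {q x : ℝ} {σ : List ℝ} (hx : x ∈ σ) (hq : q ≤ x) : q ≤ RP q σ := by
  induction σ with
  | nil => simp at hx
  | cons y ys ih =>
    cases ys with
    | nil =>
      obtain rfl : x = y := by simpa using hx
      simpa [RP] using hq
    | cons z zs =>
      rw [RP]
      · split_ifs with hy
        · exact hy
        · rcases List.mem_cons.1 hx with rfl | hx
          · exact absurd hq hy
          · exact ih hx
      · simp

theorem stmt6 (m M Hn Hp p η pstar : ℝ) (σ : List ℝ)
    (hm : 0 < m) (hmM : m ≤ M)
    (hHn0 : 0 ≤ Hn) (hHn : Hn ≤ (M - m) / M)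
    (hHp0 : 0 ≤ Hp) (hHp : Hp ≤ (M - m) / m)
    (hcond : (1 + Hp) / (1 - Hn) ≤ Real.sqrt (M / m))
    (hp : p ∈ Set.Icc m M)
    (hσ : ∀ x ∈ σ, x ∈ Set.Icc m M)
    (hmem : pstar ∈ σ) (hmax : ∀ x ∈ σ, x ≤ pstar)
    (hη : η ∈ Set.Icc 0 Hn) (herr : pstar = p * (1 - η)) :
    pstar / RP (p * (1 - Hn)) σ ≤ (1 - η) / (1 - Hn) ∧
    (1 - η) / (1 - Hn) ≤ Real.sqrt (M / m) ∧
    pstar / RP (p * (1 - Hn)) σ ≤ min ((1 - η) / (1 - Hn)) (Real.sqrt (M / m)) := by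
  obtain ⟨hη0, hηn⟩ := hη
  have hM : 0 < M := hm.trans_le hmM
  have hp0 : 0 < p := hm.trans_le hp.1
  have hHn1 : 0 < 1 - Hn := by
    have : (M - m) / M < 1 := (div_lt_one hM).2 (by linarith)
    linarith
  have hpos : 0 < p * (1 - Hn) := mul_pos hp0 hHn1
  have hle : p * (1 - Hn) ≤ pstar := by
    rw [herr]
    gcongr
  have hRP : p * (1 - Hn) ≤ RP (p * (1 - Hn)) σ := le_RP_of_mem_s6 hmem hle
  have hratio : pstar / RP (p * (1 - Hn)) σ ≤ (1 - η) / (1 - Hn) :=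
    calc pstar / RP (p * (1 - Hn)) σ ≤ pstar / (p * (1 - Hn)) :=
          div_le_div_of_nonneg_left (hpos.le.trans hle) hpos hRP
      _ = (1 - η) / (1 - Hn) := by rw [herr, mul_div_mul_left _ _ hp0.ne']
  have hsqrt : (1 - η) / (1 - Hn) ≤ Real.sqrt (M / m) :=
    (div_le_div_of_nonneg_right (by linarith) hHn1.le).trans hcond
  exact ⟨hratio, hsqrt, le_min hratio (hratio.trans hsqrt)⟩
end

section
/- Let 0 < m ≤ M, 0 ≤ H_n ≤ (M−m)/M, and 0 < H_p ≤ (M−m)/m. Let (A_p)_{p∈[m,M]} be a family of deterministic online algorithms that is robust, i.e. for every p ∈ [m, M] and every nonempty finite sequence σ of prices in [m, M] whose best price max σ equals p(1−η) for some η ∈ [0, (M−m)/M] or p(1+η) for some η ∈ (0, (M−m)/m], one has (max σ)/A_p(σ) ≤ √(M/m). Then for every η ∈ (0, H_p] and every ε > 0 there exist p ∈ [m, M] and a nonempty finite sequence σ of prices in [m, M] with max σ = p(1+η) such that (max σ)/A_p(σ) > min{(1+η)/(1−H_n), √(M/m)} − ε. (Theorem 4, positive-error case: the worst-case ratio of any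 robust non-oblivious algorithm at positive error η is at least min{(1+η)/(1−H_n), √(M/m)}.) -/
/-- Auxiliary: profit of a deterministic online algorithm `A` given the history
`pre` of already-rejected prices and the remaining price sequence. -/
def profitAux (A : List ℝ → Bool) : List ℝ → List ℝ → ℝ
  | _, [] => 0
  | _, [x] => x
  | pre, x :: xs => if A (pre ++ [x]) then x else profitAux A (pre ++ [x]) xs

/-- Profit of a deterministic online algorithm `A` on input `σ`: the price `σ_i`
for the least `i` with `A (σ_1, …, σ_i) = true`, or the last price otherwise. -/
def profit (A : List ℝ → Bool) (σ : List ℝ) : ℝ := profitAux A [] σ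

/-- Every best price in `[m, M]` is reachable from every prediction in `[m, M]` by an
admissible negative or positive error. -/
lemma exists_error_of_mem_Icc {m M p q : ℝ} (hm : 0 < m) (hp : p ∈ Set.Icc m M)
    (hq : q ∈ Set.Icc m M) :
    (∃ η ∈ Set.Icc 0 ((M - m) / M), q = p * (1 - η)) ∨
      (∃ η ∈ Set.Ioc 0 ((M - m) / m), q = p * (1 + η)) := by
  have hp0 : 0 < p := hm.trans_le hp.1
  have hM0 : 0 < M := hp0.trans_le hp.2
  rcases le_or_gt q p with h | h
  · refine Or.inl ⟨(p - q) / p, ⟨div_nonneg (sub_nonneg.2 h) hp0.le, ?_⟩, ?_⟩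
    · rw [div_le_div_iff₀ hp0 hM0]
      nlinarith [mul_le_mul hp.2 hq.1 hm.le hM0.le]
    · field_simp
      ring
  · refine Or.inr ⟨(q - p) / p, ⟨div_pos (sub_pos.2 h) hp0, ?_⟩, ?_⟩
    · rw [div_le_div_iff₀ hp0 hm]
      nlinarith [mul_le_mul hq.2 hp.1 hm.le hM0.le]
    · field_simp
      ring

lemma profit_pair (A : List ℝ → Bool) (x y : ℝ) :
    profit A [x, y] = if A [x] then x else y := by
  simp [profit, profitAux]

theorem stmt9 (m M Hn Hp : ℝ) (hm : 0 < m) (hmM : m ≤ M)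
    (hHn0 : 0 ≤ Hn) (hHn : Hn ≤ (M - m) / M)
    (hHp0 : 0 < Hp) (hHp : Hp ≤ (M - m) / m)
    (A : ℝ → List ℝ → Bool)
    (hrobust : ∀ p ∈ Set.Icc m M, ∀ σ : List ℝ, ∀ pstar : ℝ,
      (∀ x ∈ σ, x ∈ Set.Icc m M) → pstar ∈ σ → (∀ x ∈ σ, x ≤ pstar) →
      ((∃ η ∈ Set.Icc 0 ((M - m) / M), pstar = p * (1 - η)) ∨
       (∃ η ∈ Set.Ioc 0 ((M - m) / m), pstar = p * (1 + η))) →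
      pstar / profit (A p) σ ≤ Real.sqrt (M / m)) :
    ∀ η ∈ Set.Ioc 0 Hp, ∀ ε > (0 : ℝ), ∃ p ∈ Set.Icc m M, ∃ σ : List ℝ,
      σ ≠ [] ∧ (∀ x ∈ σ, x ∈ Set.Icc m M) ∧
      (p * (1 + η) ∈ σ) ∧ (∀ x ∈ σ, x ≤ p * (1 + η)) ∧
      p * (1 + η) / profit (A p) σ > min ((1 + η) / (1 - Hn)) (Real.sqrt (M / m)) - ε := by
  intro η hη ε hε
  have hM0 : 0 < M := hm.trans_le hmM
  have hlt : m < M := by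
    have h := (div_pos_iff_of_pos_right hm).1 (hHp0.trans_le hHp)
    linarith
  have hη1 : 0 < 1 + η := by linarith [hη.1]
  set s := Real.sqrt (M / m) with hs
  have hs2 : s ^ 2 = M / m := Real.sq_sqrt (by positivity)
  have hMs : M = m * s ^ 2 := by rw [hs2]; field_simp
  have hs1 : 1 < s := by
    rw [hs, Real.lt_sqrt (by norm_num), one_pow, one_lt_div hm]
    exact hlt
  have hp : M / (1 + η) ∈ Set.Icc m M := by
    constructor
    · rw [le_div_iff₀ hη1]
      have h := (le_div_iff₀ hm).1 (hη.2.trans hHp)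
      linarith
    · exact div_le_self hM0.le (by linarith [hη.1])
  have hpM : M / (1 + η) * (1 + η) = M := div_mul_cancel₀ _ hη1.ne'
  obtain ⟨t, hst, hts, htε⟩ : ∃ t, s < t ∧ t ≤ s ^ 2 ∧ t ≤ s + ε :=
    ⟨min (s ^ 2) (s + ε), lt_min (by nlinarith) (by linarith), min_le_left _ _,
      min_le_right _ _⟩
  have ht0 : 0 < t := by linarith
  have hq : m * t ∈ Set.Icc m M := by
    constructor
    · nlinarith
    · rw [hMs]
      gcongr
  have hacc : A (M / (1 + η)) [m * t] = true := by
    by_contra hrej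
    have h := hrobust _ hp [m * t, m] (m * t) (by simpa [hmM] using hq) (by simp)
      (by simpa using hq.1) (exists_error_of_mem_Icc hm hp hq)
    rw [profit_pair, if_neg hrej, mul_div_cancel_left₀ _ hm.ne'] at h
    linarith
  refine ⟨M / (1 + η), hp, [m * t, M], by simp, by simpa [hmM] using hq, by simp [hpM],
    by simpa [hpM] using hq.2, ?_⟩
  rw [profit_pair, if_pos hacc, hpM]
  have hratio : s - ε < M / (m * t) := by
    rw [hMs, mul_div_mul_left _ _ hm.ne', lt_div_iff₀ ht0]
    rcases le_or_gt (s - ε) 0 with h | h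
    · nlinarith
    · nlinarith [mul_le_mul_of_nonneg_left htε h.le, mul_pos hε hε]
  linarith [min_le_right ((1 + η) / (1 - Hn)) s]
end

section
/- Let 0 ≤ H ≤ n−1 and let P′ ∈ {0,1}^n be a response string in which at most H responses are wrong and which, whenever it contains a 1, has at most H zeros after its first 1 (as is guaranteed by RLIS's preprocessing). Define the reservation price q of RLIS as follows: if P′ contains a 1, let i₁ be its first 1-index and α the number of 0s after i₁, and set q = a_l with l = max{0, i₁ − (H+1−α)}; if P′ is all zeros, set q = a_{n−H}. Then q ≤ p* and p* ≤ q·(M/m)^{(2H+1)/n}. Consequently, for every nonempty finite price sequence σ with entries in [m, M] and best price p*, the reservation algorithm with reservation price q satisfies p* / RP(q, σ) ≤ (M/m)^{(2H+1)/n}. (Performance guarantee of the Robust Linear Interval Search algorithm, Theorem 5.) -/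
/-- The grid point `a_i = m · (M/m)^{i/n}`. -/
noncomputable def aVal (m M : ℝ) (n i : ℕ) : ℝ := m * (M / m) ^ ((i : ℝ) / (n : ℝ))

/-- The correct response to query `Q_i` ("is `p* ∈ E_i = [m, a_i)`?"):
`true` (i.e. 1) iff `p* < a_i`. -/
noncomputable def correctResp (m M : ℝ) (n : ℕ) (pstar : ℝ) (i : ℕ) : Bool :=
  decide (pstar < aVal m M n i)

theorem aVal_zero (m M : ℝ) (n : ℕ) : aVal m M n 0 = m := by
  simp [aVal]

theorem aVal_self {m M : ℝ} {n : ℕ} (hm : 0 < m) (hn : n ≠ 0) : aVal m M n n = M := by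
  have hn' : (n : ℝ) ≠ 0 := by exact_mod_cast hn
  simp only [aVal, div_self hn', Real.rpow_one]
  field_simp

theorem aVal_pos {m M : ℝ} (hm : 0 < m) (hmM : m ≤ M) (n i : ℕ) : 0 < aVal m M n i :=
  mul_pos hm (Real.rpow_pos_of_pos (div_pos (hm.trans_le hmM) hm) _)

theorem aVal_mono {m M : ℝ} (hm : 0 < m) (hmM : m ≤ M) (n : ℕ) : Monotone (aVal m M n) := by
  intro i j hij
  have h1 : 1 ≤ M / m := (one_le_div hm).2 hmM
  unfold aVal
  gcongr

theorem aVal_add {m M : ℝ} (hm : 0 < m) (hmM : m ≤ M) (n i c : ℕ) :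
    aVal m M n (i + c) = aVal m M n i * (M / m) ^ ((c : ℝ) / (n : ℝ)) := by
  rw [aVal, aVal, mul_assoc, ← Real.rpow_add (div_pos (hm.trans_le hmM) hm), Nat.cast_add,
    add_div]

/-- If some price reaches the reservation price, so does the profit. -/
theorem le_RP {q : ℝ} : ∀ {σ : List ℝ}, (∃ x ∈ σ, q ≤ x) → q ≤ RP q σ
  | [], h => by simp at h
  | [x], h => by simpa [RP] using h
  | x :: y :: ys, h => by
    rw [RP]
    · split_ifs with hx
      · exact hx
      · refine le_RP ?_
        obtain ⟨z, hz, hqz⟩ := h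
        rcases List.mem_cons.1 hz with rfl | hz
        · exact absurd hqz hx
        · exact ⟨z, hz, hqz⟩
    · simp

/-- If more than `H` indices above `l` are answered 0 and at most `H` responses are wrong,
then `a_l ≤ p*`. -/
theorem aVal_le_of_card_lt {m M pstar : ℝ} {n H l : ℕ} {P' : ℕ → Bool}
    (hm : 0 < m) (hmM : m ≤ M)
    (hwrong : ((Finset.Icc 1 n).filter
        (fun i => P' i ≠ correctResp m M n pstar i)).card ≤ H)
    (S : Finset ℕ) (hS : ∀ i ∈ S, i ∈ Finset.Icc 1 n ∧ l ≤ i ∧ P' i = false)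
    (hcard : H < S.card) : aVal m M n l ≤ pstar := by
  by_contra! h
  refine absurd ((Finset.card_le_card fun i hi => ?_).trans hwrong) (not_le.2 hcard)
  obtain ⟨hin, hli, hP⟩ := hS i hi
  refine Finset.mem_filter.2 ⟨hin, ?_⟩
  simp [hP, correctResp, h.trans_le (aVal_mono hm hmM n hli)]

/-- If more than `H` indices up to `u` are answered 1 and at most `H` responses are wrong,
then `p* ≤ a_u`. -/
theorem le_aVal_of_card_lt {m M pstar : ℝ} {n H u : ℕ} {P' : ℕ → Bool}
    (hm : 0 < m) (hmM : m ≤ M)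
    (hwrong : ((Finset.Icc 1 n).filter
        (fun i => P' i ≠ correctResp m M n pstar i)).card ≤ H)
    (S : Finset ℕ) (hS : ∀ i ∈ S, i ∈ Finset.Icc 1 n ∧ i ≤ u ∧ P' i = true)
    (hcard : H < S.card) : pstar ≤ aVal m M n u := by
  by_contra! h
  refine absurd ((Finset.card_le_card fun i hi => ?_).trans hwrong) (not_le.2 hcard)
  obtain ⟨hin, hiu, hP⟩ := hS i hi
  refine Finset.mem_filter.2 ⟨hin, ?_⟩
  simp [hP, correctResp, (aVal_mono hm hmM n hiu).trans h.le]

theorem stmt14 (m M : ℝ) (n H : ℕ) (pstar : ℝ)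
    (hm : 0 < m) (hmM : m ≤ M) (hHn : H + 1 ≤ n)
    (hps : pstar ∈ Set.Icc m M)
    (P' : ℕ → Bool)
    (hwrong : ((Finset.Icc 1 n).filter
        (fun i => P' i ≠ correctResp m M n pstar i)).card ≤ H)
    -- preprocessing guarantee: at most `H` zeros after the first 1 (if any)
    (hzeros : ∀ i₁ ∈ Finset.Icc 1 n, P' i₁ = true →
      (∀ i ∈ Finset.Icc 1 n, P' i = true → i₁ ≤ i) →
      ((Finset.Ioc i₁ n).filter (fun j => P' j = false)).card ≤ H)
    (q : ℝ)
    -- if `P'` contains a 1, the reservation price is `a_l`,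
    -- `l = max {0, i₁ − (H+1−α)}` (natural subtraction)
    (hq1 : ∀ i₁ ∈ Finset.Icc 1 n, P' i₁ = true →
      (∀ i ∈ Finset.Icc 1 n, P' i = true → i₁ ≤ i) →
      q = aVal m M n
        (i₁ - (H + 1 - ((Finset.Ioc i₁ n).filter (fun j => P' j = false)).card)))
    -- if `P'` is all zeros, the reservation price is `a_{n−H}`
    (hq0 : (∀ i ∈ Finset.Icc 1 n, P' i = false) → q = aVal m M n (n - H)) :
    q ≤ pstar ∧
    pstar ≤ q * (M / m) ^ (((2 * H + 1 : ℕ) : ℝ) / (n : ℝ)) ∧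
    (∀ σ : List ℝ, σ ≠ [] → (∀ x ∈ σ, x ∈ Set.Icc m M) →
      pstar ∈ σ → (∀ x ∈ σ, x ≤ pstar) →
      pstar / RP q σ ≤ (M / m) ^ (((2 * H + 1 : ℕ) : ℝ) / (n : ℝ))) := by
  have hn : n ≠ 0 := by omega
  have htop : ∀ u, n ≤ u → pstar ≤ aVal m M n u := fun u hu =>
    hps.2.trans ((aVal_self hm hn).symm.le.trans (aVal_mono hm hmM n hu))
  obtain ⟨l, rfl, hlow, hup⟩ : ∃ l, q = aVal m M n l ∧ aVal m M n l ≤ pstar ∧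
      pstar ≤ aVal m M n (l + (2 * H + 1)) := by
    by_cases hex : ∃ i, i ∈ Finset.Icc 1 n ∧ P' i = true
    · obtain ⟨i₁, ⟨hi₁, hP⟩, hmin⟩ : ∃ i₁, (i₁ ∈ Finset.Icc 1 n ∧ P' i₁ = true) ∧
          ∀ i ∈ Finset.Icc 1 n, P' i = true → i₁ ≤ i :=
        ⟨Nat.find hex, Nat.find_spec hex, fun i hi h => Nat.find_min' hex ⟨hi, h⟩⟩
      have hα := hzeros i₁ hi₁ hP hmin
      refine ⟨_, hq1 i₁ hi₁ hP hmin, ?_, ?_⟩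
      all_goals
        set Z := (Finset.Ioc i₁ n).filter (fun j => P' j = false) with hZ
        obtain ⟨h1, h1n⟩ := Finset.mem_Icc.1 hi₁
        set l := i₁ - (H + 1 - Z.card) with hl
      · rcases Nat.eq_zero_or_pos l with h0 | hpos
        · rw [h0, aVal_zero]
          exact hps.1
        · have hdisj : Disjoint (Finset.Ico l i₁) Z := by
            refine Finset.disjoint_left.2 fun i hi hi' => ?_
            have := (Finset.mem_Ioc.1 (Finset.mem_filter.1 hi').1).1
            have := (Finset.mem_Ico.1 hi).2
            omega
          refine aVal_le_of_card_lt hm hmM hwrong (Finset.Ico l i₁ ∪ Z) (fun i hi => ?_) ?_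
          · rcases Finset.mem_union.1 hi with hi | hi
            · rw [Finset.mem_Ico] at hi
              have hin : i ∈ Finset.Icc 1 n := Finset.mem_Icc.2 (by omega)
              refine ⟨hin, hi.1, ?_⟩
              by_contra hne
              have := hmin i hin (by simpa using hne)
              omega
            · obtain ⟨hi, hPi⟩ := Finset.mem_filter.1 hi
              rw [Finset.mem_Ioc] at hi
              exact ⟨Finset.mem_Icc.2 (by omega), by omega, hPi⟩
          · rw [Finset.card_union_of_disjoint hdisj, Nat.card_Ico]
            omega
      · rcases le_or_gt n (l + (2 * H + 1)) with hu | hu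
        · exact htop _ hu
        · refine le_aVal_of_card_lt hm hmM hwrong (Finset.Icc i₁ (l + (2 * H + 1)) \ Z)
            (fun i hi => ?_) ?_
          · obtain ⟨hi, hiZ⟩ := Finset.mem_sdiff.1 hi
            rw [Finset.mem_Icc] at hi
            refine ⟨Finset.mem_Icc.2 (by omega), hi.2, ?_⟩
            by_contra hne
            rcases hi.1.eq_or_lt with rfl | hlt
            · exact hne hP
            · exact hiZ (Finset.mem_filter.2
                ⟨Finset.mem_Ioc.2 (by omega), by simpa using hne⟩)
          · have := Finset.le_card_sdiff Z (Finset.Icc i₁ (l + (2 * H + 1)))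
            rw [Nat.card_Icc] at this
            omega
    · have hzero : ∀ i ∈ Finset.Icc 1 n, P' i = false := fun i hi => by
        by_contra hne
        exact hex ⟨i, hi, by simpa using hne⟩
      refine ⟨_, hq0 hzero, ?_, htop _ (by omega)⟩
      refine aVal_le_of_card_lt hm hmM hwrong (Finset.Icc (n - H) n) (fun i hi => ?_) ?_
      · rw [Finset.mem_Icc] at hi
        have hin : i ∈ Finset.Icc 1 n := Finset.mem_Icc.2 (by omega)
        exact ⟨hin, hi.1, hzero i hin⟩
      · rw [Nat.card_Icc]
        omega
  rw [aVal_add hm hmM] at hup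
  refine ⟨hlow, hup, fun σ _ _ hmem _ => ?_⟩
  have hRP : aVal m M n l ≤ RP (aVal m M n l) σ := le_RP ⟨pstar, hmem, hlow⟩
  have hr : 0 ≤ (M / m) ^ (((2 * H + 1 : ℕ) : ℝ) / (n : ℝ)) :=
    Real.rpow_nonneg (div_nonneg (hm.le.trans hmM) hm.le) _
  rw [div_le_iff₀ ((aVal_pos hm hmM n l).trans_le hRP), mul_comm]
  exact hup.trans (mul_le_mul_of_nonneg_right hRP hr)
end
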